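/- arXiv:1503.05987 — 2 statements merged into one kernel-verified Lean document; each statement's English description precedes it below -/
import Mathlib

section
/- Let (X_n)_{n∈ℤ} be a strictly stationary reversible real-valued Markov chain, g square-integrable with ∫ g dπ = 0, and Y_i = g(X_i). Then for every integer k ≥ 0, E( Y_0 (Y_{2k} + Y_{2k+1}) ) ≥ 0. -/
open MeasureTheory ProbabilityTheory Filter

noncomputable section

/-- The sigma-algebra generated by the past of the process up to time `k`. -/
def pastSigma {Ω : Type*} [MeasurableSpace Ω] (X : ℤ → Ω → ℝ) (k : ℤ) : MeasurableSpace Ω :=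
  ⨆ j : ℤ, ⨆ _ : j ≤ k, MeasurableSpace.comap (X j) inferInstance

/-- A strictly stationary, reversible, real-valued Markov chain indexed by `ℤ`. -/
structure IsStationaryReversibleMarkov {Ω : Type*} [MeasurableSpace Ω]
    (μ : Measure Ω) (X : ℤ → Ω → ℝ) : Prop where
  meas : ∀ n, Measurable (X n)
  stationary : ∀ n : ℤ,
    μ.map (fun ω => fun k : ℤ => X (k + n) ω) = μ.map (fun ω => fun k : ℤ => X k ω)
  reversible : μ.map (fun ω => (X 0 ω, X 1 ω)) = μ.map (fun ω => (X 1 ω, X 0 ω))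
  markov : ∀ (n : ℤ) (g : ℝ → ℝ), Measurable g → (∀ x, |g x| ≤ 1) →
    (μ[(fun ω => g (X (n + 1) ω)) | pastSigma X n]
      =ᵐ[μ] μ[(fun ω => g (X (n + 1) ω)) | MeasurableSpace.comap (X n) inferInstance])

namespace IsStationaryReversibleMarkov

variable {Ω : Type*} [MeasurableSpace Ω] {μ : Measure Ω} {X : ℤ → Ω → ℝ} {f u : ℝ → ℝ}

theorem map_pair_shift (hX : IsStationaryReversibleMarkov μ X) (i j n : ℤ) :
    μ.map (fun ω => (X (i + n) ω, X (j + n) ω)) = μ.map (fun ω => (X i ω, X j ω)) := by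
  have hm := hX.meas
  have he : Measurable (fun x : ℤ → ℝ => (x i, x j)) := by fun_prop
  have h := congrArg (Measure.map (fun x : ℤ → ℝ => (x i, x j))) (hX.stationary n)
  rwa [Measure.map_map he (by fun_prop), Measure.map_map he (by fun_prop)] at h

theorem integral_mul_shift (hX : IsStationaryReversibleMarkov μ X) (hu : Measurable u)
    (hf : Measurable f) (i j n : ℤ) :
    ∫ ω, u (X (i + n) ω) * f (X (j + n) ω) ∂μ = ∫ ω, u (X i ω) * f (X j ω) ∂μ := by
  have hm := hX.meas
  have hF : StronglyMeasurable (fun p : ℝ × ℝ => u p.1 * f p.2) :=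
    Measurable.stronglyMeasurable (by fun_prop)
  have h := congrArg (fun ν => ∫ p : ℝ × ℝ, u p.1 * f p.2 ∂ν) (hX.map_pair_shift i j n)
  rwa [integral_map (by fun_prop) hF.aestronglyMeasurable,
    integral_map (by fun_prop) hF.aestronglyMeasurable] at h

theorem integral_mul_swap (hX : IsStationaryReversibleMarkov μ X) (hu : Measurable u)
    (hf : Measurable f) :
    ∫ ω, u (X 0 ω) * f (X 1 ω) ∂μ = ∫ ω, f (X 0 ω) * u (X 1 ω) ∂μ := by
  have hm := hX.meas
  have hF : StronglyMeasurable (fun p : ℝ × ℝ => u p.1 * f p.2) :=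
    Measurable.stronglyMeasurable (by fun_prop)
  have h := congrArg (fun ν => ∫ p : ℝ × ℝ, u p.1 * f p.2 ∂ν) hX.reversible
  rw [integral_map (by fun_prop) hF.aestronglyMeasurable,
    integral_map (by fun_prop) hF.aestronglyMeasurable] at h
  simpa only [mul_comm] using h

theorem integrable_comp (hX : IsStationaryReversibleMarkov μ X) [IsFiniteMeasure μ]
    (hf : Measurable f) (hf1 : ∀ x, |f x| ≤ 1) (n : ℤ) : Integrable (fun ω => f (X n ω)) μ :=
  Integrable.of_bound (hf.comp (hX.meas n)).aestronglyMeasurable 1 (ae_of_all _ fun _ => hf1 _)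

theorem integrable_mul (hX : IsStationaryReversibleMarkov μ X) [IsFiniteMeasure μ]
    (hu : Measurable u) (hu1 : ∀ x, |u x| ≤ 1) (hf : Measurable f) (hf1 : ∀ x, |f x| ≤ 1)
    (i j : ℤ) : Integrable (fun ω => u (X i ω) * f (X j ω)) μ :=
  (hX.integrable_comp hf hf1 j).bdd_mul (hu.comp (hX.meas i)).aestronglyMeasurable
    (ae_of_all _ fun _ => hu1 _)

/-- The one-step transition operator, applied to a function bounded by one. -/
theorem exists_transition (hX : IsStationaryReversibleMarkov μ X) [IsProbabilityMeasure μ]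
    (hf : Measurable f) (hf1 : ∀ x, |f x| ≤ 1) :
    ∃ h : ℝ → ℝ, Measurable h ∧ (∀ x, |h x| ≤ 1) ∧
      ∀ n, μ[(fun ω => f (X (n + 1) ω)) | pastSigma X n] =ᵐ[μ] fun ω => h (X n ω) := by
  have hle (n : ℤ) : MeasurableSpace.comap (X n) inferInstance ≤ ‹MeasurableSpace Ω› :=
    (hX.meas n).comap_le
  obtain ⟨h₀, hh₀, he₀⟩ := StronglyMeasurable.exists_eq_measurable_comp
    (stronglyMeasurable_condExp (μ := μ) (m := MeasurableSpace.comap (X 0) inferInstance)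
      (f := fun ω => f (X 1 ω)))
  obtain ⟨h, hh, hh1, hc⟩ : ∃ h : ℝ → ℝ, Measurable h ∧ (∀ x, |h x| ≤ 1) ∧
      (fun ω => h (X 0 ω)) =ᵐ[μ]
        μ[(fun ω => f (X 1 ω)) | MeasurableSpace.comap (X 0) inferInstance] := by
    refine ⟨fun x => max (-1) (min 1 (h₀ x)), by fun_prop, fun x =>
      abs_le.2 ⟨le_max_left _ _, max_le (by norm_num) (min_le_left _ _)⟩, ?_⟩
    filter_upwards [ae_bdd_abs_condExp_of_ae_bdd_abs (R := (1 : ℝ)) (μ := μ)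
      (m := MeasurableSpace.comap (X 0) inferInstance) (f := fun ω => f (X 1 ω))
      (ae_of_all _ fun _ => hf1 _)] with ω hω
    rw [he₀] at hω ⊢
    have hω' := abs_le.1 hω
    simp only [Function.comp_apply] at hω' ⊢
    rw [min_eq_right hω'.2, max_eq_right hω'.1]
  refine ⟨h, hh, hh1, fun n => (hX.markov n f hf hf1).trans (EventuallyEq.symm ?_)⟩
  refine ae_eq_condExp_of_forall_setIntegral_eq (hle n) (hX.integrable_comp hf hf1 (n + 1))
    (fun s _ _ => (hX.integrable_comp hh hh1 n).integrableOn) ?_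
    (hh.comp (comap_measurable (X n))).aestronglyMeasurable
  rintro _ ⟨B, hB, rfl⟩ -
  have hind (v : ℝ → ℝ) (m j : ℤ) : ∫ ω in X m ⁻¹' B, v (X j ω) ∂μ =
      ∫ ω, B.indicator 1 (X m ω) * v (X j ω) ∂μ := by
    rw [← integral_indicator (hX.meas m hB)]
    refine integral_congr_ae (ae_of_all _ fun ω => ?_)
    by_cases hω : X m ω ∈ B <;> simp [Set.indicator, hω]
  have hB1 : Measurable (B.indicator (1 : ℝ → ℝ)) := measurable_one.indicator hB
  have h1 := hX.integral_mul_shift hB1 hh 0 0 n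
  have h2 := hX.integral_mul_shift hB1 hf 0 1 n
  rw [zero_add] at h1 h2
  rw [add_comm 1 n] at h2
  rw [hind, hind, h1, h2, ← hind, ← hind, setIntegral_congr_ae₀ (hX.meas 0 hB).nullMeasurableSet
      (hc.mono fun _ hx _ => hx),
    setIntegral_condExp (hle 0) (hX.integrable_comp hf hf1 1) ⟨B, hB, rfl⟩]

/-- The transition operator `P` satisfies `E(u(X_0) f(X_{n+1})) = E(u(X_0) (Pf)(X_n))`. -/
theorem exists_transition_integral (hX : IsStationaryReversibleMarkov μ X)
    [IsProbabilityMeasure μ] (hf : Measurable f) (hf1 : ∀ x, |f x| ≤ 1) :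
    ∃ h : ℝ → ℝ, (Measurable h ∧ ∀ x, |h x| ≤ 1) ∧
      ∀ (n : ℕ) (u : ℝ → ℝ), Measurable u → (∀ x, |u x| ≤ 1) →
        ∫ ω, u (X 0 ω) * f (X (n + 1) ω) ∂μ = ∫ ω, u (X 0 ω) * h (X n ω) ∂μ := by
  obtain ⟨h, hh, hh1, hc⟩ := hX.exists_transition hf hf1
  refine ⟨h, ⟨hh, hh1⟩, fun n u hu hu1 => ?_⟩
  have hle : pastSigma X n ≤ ‹MeasurableSpace Ω› :=
    iSup₂_le fun j _ => (hX.meas j).comap_le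
  have hm : Measurable[pastSigma X n] (X 0) :=
    (comap_measurable (X 0)).mono
      (le_iSup₂_of_le (0 : ℤ) (Int.natCast_nonneg n) le_rfl) le_rfl
  have hpull := condExp_mul_of_stronglyMeasurable_left (μ := μ)
    (hu.comp hm).stronglyMeasurable (hX.integrable_mul hu hu1 hf hf1 0 (n + 1))
    (hX.integrable_comp hf hf1 (n + 1))
  calc ∫ ω, u (X 0 ω) * f (X (n + 1) ω) ∂μ
      = ∫ ω, (μ[(u ∘ X 0) * (fun ω => f (X (n + 1) ω)) | pastSigma X n]) ω ∂μ :=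
        (integral_condExp hle).symm
    _ = ∫ ω, u (X 0 ω) * h (X n ω) ∂μ := by
        refine integral_congr_ae ?_
        filter_upwards [hpull, hc n] with ω h1 h2
        rw [h1, Pi.mul_apply, h2, Function.comp_apply]

theorem cov_nonneg_of_bounded (hX : IsStationaryReversibleMarkov μ X)
    [IsProbabilityMeasure μ] (hf : Measurable f) (hf1 : ∀ x, |f x| ≤ 1) (k : ℕ) :
    0 ≤ ∫ ω, f (X 0 ω) * (f (X (2 * (k : ℤ)) ω) + f (X (2 * (k : ℤ) + 1) ω)) ∂μ := by
  let B := {f : ℝ → ℝ // Measurable f ∧ ∀ x, |f x| ≤ 1}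
  choose P hP using fun f : B => hX.exists_transition_integral f.2.1 f.2.2
  let T : B → B := fun f => ⟨P f, (hP f).1⟩
  let a (n : ℤ) (u f : B) : ℝ := ∫ ω, u.1 (X 0 ω) * f.1 (X n ω) ∂μ
  have hT (n : ℕ) (u f : B) : a (n + 1) u f = a n u (T f) := (hP f).2 n u.1 u.2.1 u.2.2
  have a_comm (u f : B) : a 0 u f = a 0 f u := by simp only [a, mul_comm]
  have hsymm (u f : B) : a 0 u (T f) = a 0 (T u) f := by
    rw [a_comm (T u) f]
    have h1 := hT 0 u f
    have h2 := hT 0 f u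
    simp only [Nat.cast_zero, zero_add] at h1 h2
    rw [← h1, ← h2]
    exact hX.integral_mul_swap u.2.1 f.2.1
  have hiter (n m : ℕ) (u f : B) : a (n + m : ℕ) u f = a n u (T^[m] f) := by
    induction m generalizing f with
    | zero => rfl
    | succ m ih =>
      rw [Function.iterate_succ_apply, ← ih, ← hT, ← add_assoc]
      push_cast
      rfl
  have hiter_symm (m : ℕ) (u f : B) : a 0 u (T^[m] f) = a 0 (T^[m] u) f := by
    induction m generalizing u with
    | zero => rfl
    | succ m ih => rw [Function.iterate_succ_apply', hsymm, ih, Function.iterate_succ_apply]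
  let b : B := ⟨f, hf, hf1⟩
  let w : B := T^[k] b
  have heven : a (2 * k) b b = a 0 w w := by
    have h := hiter 0 (k + k) b b
    rw [Function.iterate_add_apply, Nat.cast_zero, hiter_symm] at h
    rw [← h]
    congr 1
    push_cast
    ring
  have hodd : a (2 * k + 1) b b = a 1 w w := by
    have h := hiter 0 (k + 1 + k) b b
    rw [add_assoc, Function.iterate_add_apply, Nat.cast_zero, hiter_symm,
      Function.iterate_add_apply] at h
    have h1 := hT 0 w w
    rw [Nat.cast_zero, zero_add] at h1
    rw [h1]
    refine Eq.trans ?_ h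
    congr 1
    push_cast
    ring
  have hw := w.2
  have hsum : ∫ ω, f (X 0 ω) * (f (X (2 * (k : ℤ)) ω) + f (X (2 * (k : ℤ) + 1) ω)) ∂μ =
      a 0 w w + a 1 w w := by
    rw [← heven, ← hodd]
    simp only [mul_add]
    exact integral_add (hX.integrable_mul hf hf1 hf hf1 _ _) (hX.integrable_mul hf hf1 hf hf1 _ _)
  have hsq : ∫ ω, (w.1 (X 0 ω) + w.1 (X 1 ω)) ^ 2 ∂μ = 2 * (a 0 w w + a 1 w w) := by
    have h1 : ∫ ω, w.1 (X 1 ω) * w.1 (X 1 ω) ∂μ = a 0 w w := by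
      simpa using hX.integral_mul_shift hw.1 hw.1 0 0 1
    have hi (i j : ℤ) := hX.integrable_mul hw.1 hw.2 hw.1 hw.2 i j
    calc ∫ ω, (w.1 (X 0 ω) + w.1 (X 1 ω)) ^ 2 ∂μ
        = ∫ ω, (w.1 (X 0 ω) * w.1 (X 0 ω) + w.1 (X 1 ω) * w.1 (X 1 ω))
            + 2 * (w.1 (X 0 ω) * w.1 (X 1 ω)) ∂μ := by
          congr 1
          ext ω
          ring
      _ = 2 * (a 0 w w + a 1 w w) := by
          have hd : Integrable (fun ω => w.1 (X 0 ω) * w.1 (X 0 ω) + w.1 (X 1 ω) * w.1 (X 1 ω)) μ :=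
            (hi 0 0).add (hi 1 1)
          rw [integral_add hd ((hi 0 1).const_mul 2),
            integral_add (hi 0 0) (hi 1 1), integral_const_mul, h1]
          simp only [a]
          ring
  have hpos : 0 ≤ ∫ ω, (w.1 (X 0 ω) + w.1 (X 1 ω)) ^ 2 ∂μ :=
    integral_nonneg fun _ => sq_nonneg _
  rw [hsum]
  linarith

theorem memLp_comp (hX : IsStationaryReversibleMarkov μ X) (hf : Measurable f)
    (hf2 : Integrable (fun x => f x ^ 2) (μ.map (X 0))) (n : ℤ) :
    MemLp (fun ω => f (X n ω)) 2 μ := by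
  have hmap : μ.map (X n) = μ.map (X 0) := by
    have h := congrArg (Measure.map Prod.fst) (hX.map_pair_shift 0 0 n)
    have hm := hX.meas
    rw [Measure.map_map (by fun_prop) (by fun_prop),
      Measure.map_map (by fun_prop) (by fun_prop)] at h
    simpa [Function.comp_def] using h
  rw [← hmap] at hf2
  exact (memLp_two_iff_integrable_sq (hf.comp (hX.meas n)).aestronglyMeasurable).2
    (hf2.comp_measurable (hX.meas n))

end IsStationaryReversibleMarkov

/-- Lemma 1, relation (8): `E(Y_0 (Y_{2k} + Y_{2k+1})) ≥ 0`. -/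
theorem cov_even_plus_odd_nonneg {Ω : Type*} [MeasurableSpace Ω]
    (μ : Measure Ω) [IsProbabilityMeasure μ]
    (X : ℤ → Ω → ℝ) (hX : IsStationaryReversibleMarkov μ X)
    (g : ℝ → ℝ) (hg_meas : Measurable g)
    (hg_sq : Integrable (fun x => g x ^ 2) (μ.map (X 0)))
    (hg_mean : ∫ x, g x ∂(μ.map (X 0)) = 0)
    (k : ℕ) :
    0 ≤ ∫ ω, g (X 0 ω) * (g (X (2 * (k : ℤ)) ω) + g (X (2 * (k : ℤ) + 1) ω)) ∂μ := by
  let t (N : ℕ) (x : ℝ) : ℝ := max (-(N + 1)) (min (N + 1) (g x))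
  have ht_meas (N : ℕ) : Measurable (t N) := by fun_prop
  have hpos (N : ℕ) : (0 : ℝ) < N + 1 := by positivity
  have ht_le (N : ℕ) (x : ℝ) : |t N x| ≤ N + 1 :=
    abs_le.2 ⟨le_max_left _ _, max_le (by linarith [hpos N]) (min_le_left _ _)⟩
  have ht_abs (N : ℕ) (x : ℝ) : |t N x| ≤ |g x| := by
    have := hpos N
    rcases le_total (g x) 0 with h | h
    · rw [abs_of_nonpos h]
      refine abs_le.2 ⟨?_, max_le (by linarith) ((min_le_right _ _).trans (by linarith))⟩
      rw [neg_neg]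
      exact (le_min (by linarith) le_rfl).trans (le_max_right _ _)
    · rw [abs_of_nonneg h]
      refine abs_le.2 ⟨?_, max_le (by linarith) (min_le_right _ _)⟩
      exact le_trans (by linarith [le_min this.le h]) (le_max_right _ _)
  have ht_lim (x : ℝ) : Tendsto (fun N => t N x) atTop (nhds (g x)) := by
    refine tendsto_const_nhds.congr' ?_
    obtain ⟨M, hM⟩ := exists_nat_ge |g x|
    filter_upwards [eventually_ge_atTop M] with N hN
    have hMN : (M : ℝ) ≤ N := by exact_mod_cast hN
    have := abs_le.1 (hM.trans hMN)
    simp only [t]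
    rw [min_eq_right (by linarith), max_eq_right (by linarith)]
  have ht_nonneg (N : ℕ) :
      0 ≤ ∫ ω, t N (X 0 ω) * (t N (X (2 * (k : ℤ)) ω) + t N (X (2 * (k : ℤ) + 1) ω)) ∂μ := by
    have hb := hX.cov_nonneg_of_bounded (f := fun x => t N x / (N + 1))
      ((ht_meas N).div_const _)
      (fun x => by
        rw [abs_div, abs_of_pos (hpos N)]
        exact div_le_one_of_le₀ (ht_le N x) (hpos N).le) k
    have hmul := mul_nonneg (sq_nonneg ((N : ℝ) + 1)) hb
    rw [← integral_const_mul] at hmul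
    refine hmul.trans_eq (integral_congr_ae (ae_of_all _ fun ω => ?_))
    have := (hpos N).ne'
    field_simp
  have hL (n : ℤ) := hX.memLp_comp hg_meas hg_sq n
  refine ge_of_tendsto' (tendsto_integral_of_dominated_convergence
    (fun ω => |g (X 0 ω)| * (|g (X (2 * (k : ℤ)) ω)| + |g (X (2 * (k : ℤ) + 1) ω)|))
    (fun N => ?_) ?_ (fun N => ae_of_all _ fun ω => ?_) (ae_of_all _ fun ω => ?_)) ht_nonneg
  · have hm := hX.meas
    exact Measurable.aestronglyMeasurable (by fun_prop)
  · exact (hL 0).abs.integrable_mul ((hL _).abs.add (hL _).abs)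
  · rw [Real.norm_eq_abs, abs_mul]
    exact mul_le_mul (ht_abs N _)
      ((abs_add_le _ _).trans (add_le_add (ht_abs N _) (ht_abs N _)))
      (abs_nonneg _) (abs_nonneg _)
  · exact (ht_lim _).mul ((ht_lim _).add (ht_lim _))
end
end

section
/- Let (X_n)_{n∈ℤ} be a strictly stationary reversible real-valued Markov chain, g square-integrable with ∫ g dπ = 0, and Y_i = g(X_i). Then for every positive integer ℓ and every integer j ≥ 2ℓ, ∑_{k=2ℓ}^{j} E(Y_0 Y_k) ≥ 0. -/
open MeasureTheory ProbabilityTheory Filter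

noncomputable section

section Transition

variable {Ω : Type*} [MeasurableSpace Ω] {μ : Measure Ω} {X : ℤ → Ω → ℝ}

/-- Measurable functions bounded by `1` in absolute value. -/
def IsUnitBounded (f : ℝ → ℝ) : Prop := Measurable f ∧ ∀ x, |f x| ≤ 1

/-- The one-step transition operator of the process `X`. -/
def transition (μ : Measure Ω) [IsProbabilityMeasure μ] (X : ℤ → Ω → ℝ) (f : ℝ → ℝ) (x : ℝ) : ℝ :=
  ∫ y, f y ∂(condDistrib (X 1) (X 0) μ x)

lemma IsUnitBounded.integrable_mul [IsFiniteMeasure μ] {f g : ℝ → ℝ} (hf : IsUnitBounded f)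
    (hg : IsUnitBounded g) {U V : Ω → ℝ} (hU : Measurable U) (hV : Measurable V) :
    Integrable (fun ω => f (U ω) * g (V ω)) μ := by
  refine Integrable.of_bound (C := 1)
    ((hf.1.comp hU).mul (hg.1.comp hV)).aestronglyMeasurable (.of_forall fun ω => ?_)
  rw [Real.norm_eq_abs, abs_mul]
  exact mul_le_one₀ (hf.2 _) (abs_nonneg _) (hg.2 _)

lemma IsUnitBounded.integrable_comp [IsFiniteMeasure μ] {f : ℝ → ℝ} (hf : IsUnitBounded f)
    {U : Ω → ℝ} (hU : Measurable U) : Integrable (fun ω => f (U ω)) μ :=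
  Integrable.of_bound (C := 1) (hf.1.comp hU).aestronglyMeasurable (.of_forall fun _ => hf.2 _)

namespace IsStationaryReversibleMarkov

lemma map_pair (hX : IsStationaryReversibleMarkov μ X) (n : ℤ) :
    μ.map (fun ω => (X n ω, X (n + 1) ω)) = μ.map (fun ω => (X 0 ω, X 1 ω)) := by
  have h := congrArg (Measure.map fun x : ℤ → ℝ => (x 0, x 1)) (hX.stationary n)
  have := hX.meas
  rw [Measure.map_map (by fun_prop) (by fun_prop), Measure.map_map (by fun_prop) (by fun_prop)] at h
  simpa [Function.comp_def, add_comm] using h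

lemma map_eq (hX : IsStationaryReversibleMarkov μ X) (n : ℤ) : μ.map (X n) = μ.map (X 0) := by
  have h := congrArg (Measure.map fun x : ℤ → ℝ => x 0) (hX.stationary n)
  have := hX.meas
  rw [Measure.map_map (by fun_prop) (by fun_prop), Measure.map_map (by fun_prop) (by fun_prop)] at h
  simpa [Function.comp_def] using h

end IsStationaryReversibleMarkov

variable [IsProbabilityMeasure μ]

lemma IsUnitBounded.transition {f : ℝ → ℝ} (hf : IsUnitBounded f) :
    IsUnitBounded (transition μ X f) := by
  refine ⟨(hf.1.stronglyMeasurable.integral_kernel).measurable, fun x => ?_⟩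
  simpa [_root_.transition] using norm_integral_le_of_norm_le_const
    (μ := condDistrib (X 1) (X 0) μ x) (f := f) (C := 1) (.of_forall hf.2)

lemma IsUnitBounded.transition_iterate {f : ℝ → ℝ} (hf : IsUnitBounded f) (n : ℕ) :
    IsUnitBounded ((_root_.transition μ X)^[n] f) := by
  induction n with
  | zero => exact hf
  | succ n ih => rw [Function.iterate_succ_apply']; exact ih.transition

namespace IsStationaryReversibleMarkov

lemma condDistrib_eq (hX : IsStationaryReversibleMarkov μ X) (n : ℤ) :
    condDistrib (X (n + 1)) (X n) μ = condDistrib (X 1) (X 0) μ := by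
  simp only [condDistrib, hX.map_pair n]

lemma integral_mul_succ (hX : IsStationaryReversibleMarkov μ X) {f g : ℝ → ℝ}
    (hf : IsUnitBounded f) (hg : IsUnitBounded g) (n : ℕ) :
    ∫ ω, f (X 0 ω) * g (X (n + 1 : ℤ) ω) ∂μ =
      ∫ ω, f (X 0 ω) * transition μ X g (X (n : ℤ) ω) ∂μ := by
  have hm := hX.meas
  have hle : pastSigma X n ≤ ‹MeasurableSpace Ω› :=
    iSup₂_le fun j _ => (hX.meas j).comap_le
  have hX0 : Measurable[pastSigma X n] (X 0) :=
    (comap_measurable (X 0)).mono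
      (le_iSup₂_of_le (f := fun (j : ℤ) (_ : j ≤ n) => MeasurableSpace.comap (X j) inferInstance)
        0 (by positivity) le_rfl) le_rfl
  have hf0 : StronglyMeasurable[pastSigma X n] (fun ω => f (X 0 ω)) :=
    (hf.1.comp hX0).stronglyMeasurable
  rw [← integral_condExp hle]
  refine integral_congr_ae ?_
  have h1 := condExp_mul_of_stronglyMeasurable_left (μ := μ) hf0
    (hf.integrable_mul hg (hm 0) (hm (n + 1))) (hg.integrable_comp (hm (n + 1)))
  have h2 := condExp_ae_eq_integral_condDistrib (hm n) (hm (n + 1)).aemeasurable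
    hg.1.stronglyMeasurable (hg.integrable_comp (μ := μ) (hm (n + 1)))
  filter_upwards [h1, hX.markov n g hg.1 hg.2, h2] with ω h1 h3 h2
  refine h1.trans ?_
  simp only [Pi.mul_apply]
  rw [h3, h2, hX.condDistrib_eq]
  rfl

lemma integral_mul_eq_iterate (hX : IsStationaryReversibleMarkov μ X) {f g : ℝ → ℝ}
    (hf : IsUnitBounded f) (hg : IsUnitBounded g) (n : ℕ) :
    ∫ ω, f (X 0 ω) * g (X (n : ℤ) ω) ∂μ =
      ∫ ω, f (X 0 ω) * (transition μ X)^[n] g (X 0 ω) ∂μ := by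
  induction n generalizing g with
  | zero => rfl
  | succ n ih =>
    rw [Function.iterate_succ_apply, ← ih hg.transition, ← hX.integral_mul_succ hf hg]
    simp

lemma integral_transition_comm (hX : IsStationaryReversibleMarkov μ X) {f g : ℝ → ℝ}
    (hf : IsUnitBounded f) (hg : IsUnitBounded g) :
    ∫ ω, f (X 0 ω) * transition μ X g (X 0 ω) ∂μ =
      ∫ ω, transition μ X f (X 0 ω) * g (X 0 ω) ∂μ := by
  have hm := hX.meas
  have hmeas : Measurable fun p : ℝ × ℝ => f p.1 * g p.2 :=
    (hf.1.comp measurable_fst).mul (hg.1.comp measurable_snd)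
  have h := congrArg (fun ν => ∫ p : ℝ × ℝ, f p.1 * g p.2 ∂ν) hX.reversible
  rw [integral_map (by fun_prop) hmeas.aestronglyMeasurable,
    integral_map (by fun_prop) hmeas.aestronglyMeasurable] at h
  have h1 := hX.integral_mul_succ hf hg 0
  have h2 := hX.integral_mul_succ hg hf 0
  simp only [Nat.cast_zero, zero_add] at h1 h2
  rw [← h1, h]
  simpa only [mul_comm] using h2

lemma integral_transition_iterate_comm (hX : IsStationaryReversibleMarkov μ X) {f g : ℝ → ℝ}
    (hf : IsUnitBounded f)
    (hg : IsUnitBounded g) (n : ℕ) :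
    ∫ ω, f (X 0 ω) * (transition μ X)^[n] g (X 0 ω) ∂μ =
      ∫ ω, (transition μ X)^[n] f (X 0 ω) * g (X 0 ω) ∂μ := by
  induction n generalizing f with
  | zero => rfl
  | succ n ih =>
    rw [Function.iterate_succ_apply' _ n g,
      hX.integral_transition_comm hf (hg.transition_iterate n), ih hf.transition,
      ← Function.iterate_succ_apply]

lemma integral_mul_even (hX : IsStationaryReversibleMarkov μ X) {g : ℝ → ℝ}
    (hg : IsUnitBounded g) (i : ℕ) :
    ∫ ω, g (X 0 ω) * g (X (2 * i : ℕ) ω) ∂μ =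
      ∫ ω, (transition μ X)^[i] g (X 0 ω) ^ 2 ∂μ := by
  rw [hX.integral_mul_eq_iterate hg hg, two_mul, Function.iterate_add_apply,
    hX.integral_transition_iterate_comm hg (hg.transition_iterate i)]
  simp only [sq]

lemma integral_mul_odd (hX : IsStationaryReversibleMarkov μ X) {g : ℝ → ℝ}
    (hg : IsUnitBounded g) (i : ℕ) :
    ∫ ω, g (X 0 ω) * g (X (2 * i + 1 : ℕ) ω) ∂μ =
      ∫ ω, (transition μ X)^[i] g (X 0 ω) * (transition μ X)^[i] g (X 1 ω) ∂μ := by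
  have hi := hg.transition_iterate (μ := μ) (X := X) i
  have h := hX.integral_mul_eq_iterate hi hi 1
  rw [Nat.cast_one] at h
  rw [h, hX.integral_mul_eq_iterate hg hg, ← hX.integral_transition_iterate_comm hg,
    ← Function.iterate_add_apply, ← Function.iterate_add_apply]
  · rw [show 2 * i + 1 = i + 1 + i by omega]
  · exact hi.transition

lemma integral_mul_even_nonneg (hX : IsStationaryReversibleMarkov μ X) {g : ℝ → ℝ}
    (hg : IsUnitBounded g) (i : ℕ) :
    0 ≤ ∫ ω, g (X 0 ω) * g (X (2 * i : ℕ) ω) ∂μ := by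
  rw [hX.integral_mul_even hg]
  exact integral_nonneg fun _ => sq_nonneg _

lemma integral_mul_even_add_odd_nonneg (hX : IsStationaryReversibleMarkov μ X) {g : ℝ → ℝ}
    (hg : IsUnitBounded g) (i : ℕ) :
    0 ≤ ∫ ω, g (X 0 ω) * g (X (2 * i : ℕ) ω) ∂μ +
      ∫ ω, g (X 0 ω) * g (X (2 * i + 1 : ℕ) ω) ∂μ := by
  rw [hX.integral_mul_even hg, hX.integral_mul_odd hg]
  have hi := hg.transition_iterate (μ := μ) (X := X) i
  set h := (transition μ X)^[i] g
  have hm := hX.meas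
  have h01 : ∫ ω, h (X 1 ω) ^ 2 ∂μ = ∫ ω, h (X 0 ω) ^ 2 ∂μ := by
    rw [← integral_map (f := fun x => h x ^ 2) (hm 1).aemeasurable
        (hi.1.pow_const 2).aestronglyMeasurable,
      ← integral_map (f := fun x => h x ^ 2) (hm 0).aemeasurable
        (hi.1.pow_const 2).aestronglyMeasurable, hX.map_eq 1]
  have h_int (k : ℤ) : Integrable (fun ω => h (X k ω) ^ 2) μ := by
    simpa only [sq] using hi.integrable_mul hi (hm k) (hm k)
  have hsq : 0 ≤ ∫ ω, (h (X 0 ω) ^ 2 + h (X 1 ω) ^ 2) + 2 * (h (X 0 ω) * h (X 1 ω)) ∂μ :=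
    integral_nonneg fun ω => by
      simp only [Pi.zero_apply]
      nlinarith [sq_nonneg (h (X 0 ω) + h (X 1 ω))]
  have h_int01 : Integrable (fun ω => h (X 0 ω) ^ 2 + h (X 1 ω) ^ 2) μ := (h_int 0).add (h_int 1)
  rw [integral_add h_int01 ((hi.integrable_mul hi (hm 0) (hm 1)).const_mul 2),
    integral_add (h_int 0) (h_int 1), integral_const_mul, h01] at hsq
  linarith

end IsStationaryReversibleMarkov

end Transition

lemma sum_Icc_even_nonneg {a : ℕ → ℝ} (h0 : ∀ i, 0 ≤ a (2 * i))
    (h1 : ∀ i, 0 ≤ a (2 * i) + a (2 * i + 1)) (l j : ℕ) :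
    0 ≤ ∑ k ∈ Finset.Icc (2 * l) j, a k := by
  have even (n : ℕ) : 0 ≤ ∑ k ∈ Finset.range (2 * n), a (2 * l + k) := by
    induction n with
    | zero => simp
    | succ n ih =>
      rw [Nat.mul_succ, Finset.sum_range_succ, Finset.sum_range_succ]
      have := h1 (l + n)
      rw [mul_add, add_assoc] at this
      linarith
  rw [← Finset.Ico_add_one_right_eq_Icc, Finset.sum_Ico_eq_sum_range]
  obtain ⟨n, hn | hn⟩ := Nat.even_or_odd' (j + 1 - 2 * l)
  · rw [hn]; exact even n
  · rw [hn, Finset.sum_range_succ, ← mul_add]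
    exact add_nonneg (even n) (h0 _)

/-- Clipping `x` to `[-N, N]`. -/
def clip (N x : ℝ) : ℝ := max (-N) (min N x)

lemma abs_clip_le {N : ℝ} (hN : 0 ≤ N) (x : ℝ) : |clip N x| ≤ N :=
  abs_le.2 ⟨le_max_left _ _, max_le (by linarith) (min_le_left _ _)⟩

lemma abs_clip_le_abs {N : ℝ} (hN : 0 ≤ N) (x : ℝ) : |clip N x| ≤ |x| := by
  unfold clip
  grind

lemma clip_eq_self {N x : ℝ} (h : |x| ≤ N) : clip N x = x := by
  rw [clip, min_eq_right (abs_le.1 h).2, max_eq_right (abs_le.1 h).1]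

lemma tendsto_clip (x : ℝ) : Tendsto (fun N : ℕ => clip N x) atTop (nhds x) := by
  obtain ⟨M, hM⟩ := exists_nat_ge |x|
  refine tendsto_const_nhds.congr' ?_
  filter_upwards [eventually_ge_atTop M] with N hN
  exact (clip_eq_self (hM.trans (by exact_mod_cast hN))).symm

/-- Lemma 1, relation (11): for `ℓ ≥ 1` and `j ≥ 2ℓ`, `∑_{k=2ℓ}^j E(Y_0 Y_k) ≥ 0`. -/
theorem sum_cov_nonneg {Ω : Type*} [MeasurableSpace Ω]
    (μ : Measure Ω) [IsProbabilityMeasure μ]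
    (X : ℤ → Ω → ℝ) (hX : IsStationaryReversibleMarkov μ X)
    (g : ℝ → ℝ) (hg_meas : Measurable g)
    (hg_sq : Integrable (fun x => g x ^ 2) (μ.map (X 0)))
    (hg_mean : ∫ x, g x ∂(μ.map (X 0)) = 0)
    (ℓ : ℕ) (hℓ : 1 ≤ ℓ) (j : ℕ) (hj : 2 * ℓ ≤ j) :
    0 ≤ ∑ k ∈ Finset.Icc (2 * ℓ) j, ∫ ω, g (X 0 ω) * g (X (k : ℤ) ω) ∂μ := by
  have hm := hX.meas
  have hmemLp (k : ℤ) : MemLp (fun ω => g (X k ω)) 2 μ := by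
    rw [← hX.map_eq k] at hg_sq
    refine (memLp_two_iff_integrable_sq (hg_meas.comp (hm k)).aestronglyMeasurable).2 ?_
    exact hg_sq.comp_measurable (hm k)
  have hclip (N : ℝ) : Measurable fun x => clip N (g x) :=
    measurable_const.max (measurable_const.min hg_meas)
  have hlim : Tendsto (fun N : ℕ => ∑ k ∈ Finset.Icc (2 * ℓ) j,
      ∫ ω, clip N (g (X 0 ω)) * clip N (g (X (k : ℤ) ω)) ∂μ) atTop
      (nhds (∑ k ∈ Finset.Icc (2 * ℓ) j, ∫ ω, g (X 0 ω) * g (X (k : ℤ) ω) ∂μ)) := by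
    refine tendsto_finsetSum _ fun k _ => ?_
    refine tendsto_integral_of_dominated_convergence
      (fun ω => ‖g (X 0 ω) * g (X (k : ℤ) ω)‖)
      (fun N => (((hclip N).comp (hm 0)).mul ((hclip N).comp (hm k))).aestronglyMeasurable)
      ((hmemLp 0).integrable_mul (hmemLp k)).norm (fun N => .of_forall fun ω => ?_)
      (.of_forall fun ω => (tendsto_clip _).mul (tendsto_clip _))
    rw [norm_mul, norm_mul]
    exact mul_le_mul (abs_clip_le_abs N.cast_nonneg _) (abs_clip_le_abs N.cast_nonneg _)
      (norm_nonneg _) (norm_nonneg _)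
  refine ge_of_tendsto hlim ?_
  filter_upwards [eventually_gt_atTop 0] with N hN
  have hN' : (0 : ℝ) < N := by exact_mod_cast hN
  have hb : IsUnitBounded fun x => (N : ℝ)⁻¹ * clip N (g x) := by
    refine ⟨(hclip N).const_mul _, fun x => ?_⟩
    rw [abs_mul, abs_of_pos (inv_pos.2 hN'), inv_mul_le_iff₀ hN', mul_one]
    exact abs_clip_le hN'.le _
  have hsum := sum_Icc_even_nonneg
    (a := fun k => ∫ ω, (N : ℝ)⁻¹ * clip N (g (X 0 ω)) * ((N : ℝ)⁻¹ * clip N (g (X k ω))) ∂μ)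
    (hX.integral_mul_even_nonneg hb)
    (hX.integral_mul_even_add_odd_nonneg hb) ℓ j
  simp only [mul_mul_mul_comm, integral_const_mul, ← Finset.mul_sum] at hsum
  exact nonneg_of_mul_nonneg_right hsum (by positivity)
end
end
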